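/- arXiv:2411.11198 — 3 statements merged into one kernel-verified Lean document; each statement's English description precedes it below -/
import Mathlib

section
/- Let λ ∈ ℝ, let U ⊆ ℝ^{n+1} be an open set and let f ∈ C¹(U, ℝ_n). Then the function x ↦ e^{λ Re x} f(x) is slice monogenic on U (belongs to SM(U)) if and only if f is λ-slice monogenic on U (belongs to SM_λ(U)). -/
open scoped BigOperators
open Set

noncomputable section

/-- The sphere 𝕊 of (coefficient vectors of) unit 1-vectors in ℝⁿ. -/
def USphere (n : ℕ) : Set (Fin n → ℝ) := {x | ∑ i, x i ^ 2 = 1}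

/-- Points of ℝ^{n+1}, written as (x₀, (x₁, …, xₙ)). -/
abbrev Pt (n : ℕ) := ℝ × (Fin n → ℝ)

variable {n : ℕ} {Cl : Type} [NormedRing Cl] [NormedAlgebra ℝ Cl]

/-- The 1-vector of the Clifford algebra with coefficients `x` w.r.t. generators `e`. -/
def vecEmb (e : Fin n → Cl) (x : Fin n → ℝ) : Cl := ∑ i, x i • e i

/-- The defining relations `eᵢeⱼ + eⱼeᵢ = -2δᵢⱼ` of the Clifford algebra ℝₙ. -/
def CliffordRel (e : Fin n → Cl) : Prop :=
  ∀ i j, e i * e j + e j * e i = if i = j then (-2 : Cl) else 0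

/-- The slice Cauchy–Riemann operator `(∂/∂u + I ∂/∂v)` applied to the restriction of `f`
to the slice `ℂ_I`, `I = vecEmb e x`, evaluated at the point `u + I v`. -/
def sliceCR (e : Fin n → Cl) (f : Pt n → Cl) (x : Fin n → ℝ) (u v : ℝ) : Cl :=
  deriv (fun t => f (t, v • x)) u + vecEmb e x * deriv (fun t => f (u, t • x)) v

/-- λ-slice monogenic functions on `U`. -/
def SMlam (e : Fin n → Cl) (lam : ℝ) (U : Set (Pt n)) (f : Pt n → Cl) : Prop :=
  ContDiffOn ℝ 1 f U ∧
  ∀ x ∈ USphere n, ∀ u v : ℝ, ((u, v • x) : Pt n) ∈ U →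
    sliceCR e f x u v + lam • f (u, v • x) = 0

/-- The coordinates (u,v) of the slice `U_I = U ∩ ℂ_I`, `I = vecEmb e x`. -/
def SlicePre (n : ℕ) (U : Set (Pt n)) (x : Fin n → ℝ) : Set (ℝ × ℝ) :=
  {p | ((p.1, p.2 • x) : Pt n) ∈ U}

/-- Axially symmetric slice domains in ℝ^{n+1}. -/
def AxSymSDomain (n : ℕ) (U : Set (Pt n)) : Prop :=
  IsOpen U ∧ IsConnected U ∧ (∃ u : ℝ, ((u, (0 : Fin n → ℝ)) : Pt n) ∈ U) ∧
  (∀ x ∈ USphere n, IsConnected (SlicePre n U x)) ∧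
  ∀ x ∈ USphere n, ∀ y ∈ USphere n, ∀ u v : ℝ,
    ((u, v • x) : Pt n) ∈ U → ((u, v • y) : Pt n) ∈ U

/-- A holomorphic function with values in `ℂ_I`, `I = vecEmb e x`, on a
(relatively open) coordinate set `V`. -/
def SliceHolo (e : Fin n → Cl) (x : Fin n → ℝ) (V : Set (ℝ × ℝ)) (F : ℝ × ℝ → Cl) : Prop :=
  DifferentiableOn ℝ F V ∧
  (∀ p ∈ V, ∃ a b : ℝ, F p = algebraMap ℝ Cl a + b • vecEmb e x) ∧
  ∀ p ∈ V, deriv (fun t => F (t, p.2)) p.1 + vecEmb e x * deriv (fun t => F (p.1, t)) p.2 = 0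

/-- Ordered product `I_A = I_{i₁} ⋯ I_{i_k}` over a finite index set `A`. -/
def IAprod (e : Fin n → Cl) (J : Fin n → Fin n → ℝ) (A : Finset (Fin n)) : Cl :=
  ((A.sort (· ≤ ·)).map fun i => vecEmb e (J i)).prod

/-- A closed piecewise-C¹ curve parametrized on [0,1]. -/
def PiecewiseC1 (γ : ℝ → ℝ × ℝ) : Prop :=
  ContinuousOn γ (Icc 0 1) ∧
  ∃ (k : ℕ) (t : Fin (k + 1) → ℝ), t 0 = 0 ∧ t (Fin.last k) = 1 ∧ StrictMono t ∧
    ∀ i : Fin k, ContDiffOn ℝ 1 γ (Icc (t i.castSucc) (t i.succ))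

/-- `γ` is a closed curve in `V`, homotopic within `V` to a constant curve. -/
def NullHomotopicIn (γ : ℝ → ℝ × ℝ) (V : Set (ℝ × ℝ)) : Prop :=
  γ 0 = γ 1 ∧ (∀ t ∈ Icc (0:ℝ) 1, γ t ∈ V) ∧
  ∃ (H : ℝ × ℝ → ℝ × ℝ) (p : ℝ × ℝ),
    ContinuousOn H (Icc 0 1 ×ˢ Icc 0 1) ∧
    (∀ q ∈ (Icc (0:ℝ) 1 ×ˢ Icc (0:ℝ) 1), H q ∈ V) ∧
    (∀ t ∈ Icc (0:ℝ) 1, H (0, t) = γ t) ∧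
    (∀ t ∈ Icc (0:ℝ) 1, H (1, t) = p) ∧
    (∀ s ∈ Icc (0:ℝ) 1, H (s, 0) = H (s, 1))

/-- The inverse `(a + bI)⁻¹` computed in the field `ℂ_I`, `I = vecEmb e x`. -/
def sliceInv (e : Fin n → Cl) (x : Fin n → ℝ) (a b : ℝ) : Cl :=
  (a ^ 2 + b ^ 2)⁻¹ • (algebraMap ℝ Cl a - b • vecEmb e x)

/-- The closed Euclidean ball of ℝ^{n+1}. -/
def EucClosedBall (y : Pt n) (ρ : ℝ) : Set (Pt n) :=
  {p | (p.1 - y.1) ^ 2 + ∑ i, (p.2 i - y.2 i) ^ 2 ≤ ρ ^ 2}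

/-- Left fractional integral of order `σ` with respect to `g` (with derivative `g'`),
with base point `aa`. -/
def fracInt (aa σ : ℝ) (g g' : ℝ → ℝ) (φ : ℝ → Cl) (u : ℝ) : Cl :=
  (Real.Gamma σ)⁻¹ • ∫ τ in aa..u, ((g u - g τ) ^ (σ - 1) * g' τ) • φ τ

/-- Right fractional integral of order `σ` with respect to `h` (with derivative `h'`),
with base point `cc`. -/
def fracIntR (cc σ : ℝ) (h h' : ℝ → ℝ) (φ : ℝ → Cl) (v : ℝ) : Cl :=
  (Real.Gamma σ)⁻¹ • ∫ τ in v..cc, ((h τ - h v) ^ (σ - 1) * h' τ) • φ τ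

/-- Left Riemann–Liouville fractional derivative of order `al` w.r.t. `g` on `[aa, bb]`
(one-sided derivatives at the endpoints). -/
def rlD (aa bb al : ℝ) (g g' : ℝ → ℝ) (φ : ℝ → Cl) (u : ℝ) : Cl :=
  (g' u)⁻¹ • derivWithin (fracInt aa (1 - al) g g' φ) (Icc aa bb) u

/-- The set `S_{a,b,c} ⊆ ℝ^{n+1}`. -/
def Sabc (n : ℕ) (a b c : ℝ) : Set (Pt n) :=
  {p | ∃ x ∈ USphere n, ∃ u ∈ Icc a b, ∃ v ∈ Icc 0 c, p = ((u, v • x) : Pt n)}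

/-- Absolutely continuous function on `[a,b]`. -/
def AbsContOn {E : Type} [NormedAddCommGroup E] (φ : ℝ → E) (a b : ℝ) : Prop :=
  ∀ ε > (0:ℝ), ∃ δ > (0:ℝ), ∀ (k : ℕ) (p q : Fin k → ℝ),
    (∀ i, p i ∈ Icc a b ∧ q i ∈ Icc a b ∧ p i ≤ q i) →
    (∀ i j, i ≠ j → Ioo (p i) (q i) ∩ Ioo (p j) (q j) = ∅) →
    (∑ i, (q i - p i)) < δ → (∑ i, ‖φ (q i) - φ (p i)‖) < ε

/-- The class `AC¹(S_{a,b,c}, ℝₙ)`. -/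
def AC1 (a b c r s : ℝ) (f : Pt n → Cl) : Prop :=
  ContinuousOn f (Sabc n a b c) ∧
  ∀ x ∈ USphere n,
    AbsContOn (fun u => f (u, s • x)) a b ∧ AbsContOn (fun v => f (r, v • x)) 0 c

/-- `A_I(u) = (I_{a+}^{1-α,g}[τ ↦ f(τ + Is)])(u)`, where `I = vecEmb e x`. -/
def AIfun (a al s : ℝ) (g g' : ℝ → ℝ) (f : Pt n → Cl) (x : Fin n → ℝ) : ℝ → Cl :=
  fracInt a (1 - al) g g' fun τ => f (τ, s • x)

/-- `B_I(v) = (I_{0+}^{1-β,h}[τ ↦ f(r + Iτ)])(v)`, where `I = vecEmb e x`. -/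
def BIfun (be r : ℝ) (h h' : ℝ → ℝ) (f : Pt n → Cl) (x : Fin n → ℝ) : ℝ → Cl :=
  fracInt 0 (1 - be) h h' fun τ => f (r, τ • x)

/-- `B_I^{c-}(v) = (I_{c-}^{1-β,h}[τ ↦ f(r + Iτ)])(v)`, where `I = vecEmb e x`. -/
def BIcfun (c be r : ℝ) (h h' : ℝ → ℝ) (f : Pt n → Cl) (x : Fin n → ℝ) : ℝ → Cl :=
  fracIntR c (1 - be) h h' fun τ => f (r, τ • x)

/-- Condition (m1): the maps `A_I` and `B_I` are of class C¹ for every `I ∈ 𝕊`. -/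
def M1 (a b c al be r s : ℝ) (g g' h h' : ℝ → ℝ) (f : Pt n → Cl) : Prop :=
  ∀ x ∈ USphere n,
    ContDiffOn ℝ 1 (AIfun a al s g g' f x) (Icc a b) ∧
    ContDiffOn ℝ 1 (BIfun be r h h' f x) (Icc 0 c)

/-- Riemann–Liouville fractional slice monogenic functions of order `(α,β)`
with respect to `(g,h)` on `S_{a,b,c}`. -/
def RLSM (a b c al be r s : ℝ) (g g' h h' : ℝ → ℝ) (e : Fin n → Cl) (f : Pt n → Cl) : Prop :=
  AC1 a b c r s f ∧ M1 a b c al be r s g g' h h' f ∧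
  ∀ x ∈ USphere n, ∀ u ∈ Icc a b, ∀ v ∈ Icc 0 c,
    (g' u)⁻¹ • derivWithin (AIfun a al s g g' f x) (Icc a b) u +
      vecEmb e x * ((h' v)⁻¹ • derivWithin (BIfun be r h h' f x) (Icc 0 c) v) = 0


/-- The slice Cauchy–Riemann operator turns multiplication by `e^{λ Re x}` into a zeroth-order
perturbation by `λ`. -/
lemma sliceCR_exp_smul (e : Fin n → Cl) (lam : ℝ) {f : Pt n → Cl} {x : Fin n → ℝ} {u v : ℝ}
    (hf : DifferentiableAt ℝ f (u, v • x)) :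
    sliceCR e (fun p => Real.exp (lam * p.1) • f p) x u v =
      Real.exp (lam * u) • (sliceCR e f x u v + lam • f (u, v • x)) := by
  have hu : DifferentiableAt ℝ (fun t => f (t, v • x)) u :=
    DifferentiableAt.comp u (g := f) (f := fun t : ℝ => ((t, v • x) : Pt n)) hf (by fun_prop)
  have hv : DifferentiableAt ℝ (fun t => f (u, t • x)) v :=
    DifferentiableAt.comp v (g := f) (f := fun t : ℝ => ((u, t • x) : Pt n)) hf (by fun_prop)
  have hexp : HasDerivAt (fun t : ℝ => Real.exp (lam * t)) (Real.exp (lam * u) * lam) u := by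
    simpa using ((hasDerivAt_id u).const_mul lam).exp
  have hdu : deriv (fun t => Real.exp (lam * t) • f (t, v • x)) u =
      Real.exp (lam * u) • deriv (fun t => f (t, v • x)) u +
        (Real.exp (lam * u) * lam) • f (u, v • x) :=
    (hexp.smul hu.hasDerivAt).deriv
  have hdv : deriv (fun t => Real.exp (lam * u) • f (u, t • x)) v =
      Real.exp (lam * u) • deriv (fun t => f (u, t • x)) v :=
    (hv.hasDerivAt.const_smul (Real.exp (lam * u))).deriv
  simp only [sliceCR, hdu, hdv, mul_smul_comm, smul_add, mul_smul]
  abel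

/-- `x ↦ e^{λ Re x} f(x)` is slice monogenic on `U` iff `f` is
λ-slice monogenic on `U`. -/
theorem statement1 (e : Fin n → Cl) (he : CliffordRel e) (lam : ℝ)
    (U : Set (Pt n)) (hU : IsOpen U) (f : Pt n → Cl) (hf : ContDiffOn ℝ 1 f U) :
    SMlam e 0 U (fun p => Real.exp (lam * p.1) • f p) ↔ SMlam e lam U f := by
  have hdiff : ∀ p ∈ U, DifferentiableAt ℝ f p := fun p hp =>
    (hf.differentiableOn one_ne_zero).differentiableAt (hU.mem_nhds hp)
  have hexp : ContDiffOn ℝ 1 (fun p : Pt n => Real.exp (lam * p.1) • f p) U :=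
    ContDiffOn.smul (f := fun p : Pt n => Real.exp (lam * p.1)) (by fun_prop) hf
  simp only [SMlam, hf, hexp, true_and, zero_smul, add_zero]
  refine forall₅_congr fun x _ u v huv => ?_
  rw [sliceCR_exp_smul e lam (hdiff _ huv), smul_eq_zero_iff_right (Real.exp_ne_zero _)]
end
end

section
/- (Representation formula for λ-slice monogenic functions.) Let λ ∈ ℝ, let U ⊆ ℝ^{n+1} be an axially symmetric s-domain and let f ∈ SM_λ(U). Then for all u, v ∈ ℝ and I_x ∈ 𝕊 with x = u + I_x v ∈ U, and for every I ∈ 𝕊 (the points u + Iv and u − Iv lie in U by axial symmetry), f(x) = ½ (1 − I_x I) f(u + Iv) + ½ (1 + I_x I) f(u − Iv). -/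
open scoped BigOperators
open Set

noncomputable section

variable {n : ℕ} {Cl : Type} [NormedRing Cl] [NormedAlgebra ℝ Cl]

open scoped Topology

/-- A unit 1-vector squares to `-1`. -/
lemma vecEmb_mul_self {e : Fin n → Cl} (he : CliffordRel e) {x : Fin n → ℝ}
    (hx : x ∈ USphere n) : vecEmb e x * vecEmb e x = -1 := by
  have h1 : vecEmb e x * vecEmb e x = ∑ i, ∑ j, (x i * x j) • (e i * e j) := by
    simp only [vecEmb, Finset.sum_mul_sum, smul_mul_smul_comm]
  have h2 : vecEmb e x * vecEmb e x = ∑ i, ∑ j, (x i * x j) • (e j * e i) := by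
    rw [h1, Finset.sum_comm]
    exact Finset.sum_congr rfl fun i _ => Finset.sum_congr rfl fun j _ => by
      rw [mul_comm (x j)]
  have h3 : vecEmb e x * vecEmb e x + vecEmb e x * vecEmb e x = (-2 : Cl) := by
    nth_rewrite 1 [h1]
    rw [h2]
    simp only [← Finset.sum_add_distrib, ← smul_add, he _ _, smul_ite, smul_zero,
      Finset.sum_ite_eq, Finset.mem_univ, if_true, ← Finset.sum_smul]
    have hx' : ∑ i, x i * x i = 1 := by simpa [USphere, sq] using hx
    rw [hx', one_smul]
  have h4 : (2 : ℝ) • (vecEmb e x * vecEmb e x) = (2 : ℝ) • (-1 : Cl) := by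
    rw [two_smul, two_smul, h3]
    norm_num
  exact smul_right_injective Cl (two_ne_zero' ℝ) h4

/-- The slice function `u + iv ↦ f (u + I v)` is real differentiable and satisfies the
λ-Cauchy–Riemann equation. -/
lemma SMlam.exists_hasFDerivAt {e : Fin n → Cl} {lam : ℝ} {U : Set (Pt n)} (hU : IsOpen U)
    {f : Pt n → Cl} (hf : SMlam e lam U f) {x : Fin n → ℝ} (hx : x ∈ USphere n) {z : ℂ}
    (hz : ((z.re, z.im • x) : Pt n) ∈ U) :
    ∃ L : ℂ →L[ℝ] Cl, HasFDerivAt (fun w : ℂ => f (w.re, w.im • x)) L z ∧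
      L 1 + vecEmb e x * L Complex.I + lam • f (z.re, z.im • x) = 0 := by
  have hL := ((hf.1.differentiableOn one_ne_zero).differentiableAt
    (hU.mem_nhds hz)).hasFDerivAt
  have hg : HasFDerivAt (fun w : ℂ => ((w.re, w.im • x) : Pt n))
      (Complex.reCLM.prod (Complex.imCLM.smulRight x)) z :=
    (Complex.reCLM.prod (Complex.imCLM.smulRight x)).hasFDerivAt
  refine ⟨_, HasFDerivAt.comp z hL hg, ?_⟩
  have h1 : HasDerivAt (fun t : ℝ => f (t, z.im • x))
      (fderiv ℝ f (z.re, z.im • x) (1, 0)) z.re :=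
    HasFDerivAt.comp_hasDerivAt z.re hL ((hasDerivAt_id _).prodMk (hasDerivAt_const _ _))
  have h2 : HasDerivAt (fun t : ℝ => f (z.re, t • x))
      (fderiv ℝ f (z.re, z.im • x) (0, x)) z.im := by
    have h := HasFDerivAt.comp_hasDerivAt z.im hL
      ((hasDerivAt_const z.im z.re).prodMk ((hasDerivAt_id z.im).smul_const x))
    simpa [Function.comp_def] using h
  have h := hf.2 x hx z.re z.im hz
  rw [sliceCR, h1.deriv, h2.deriv] at h
  simpa using h

/-- Identity principle for the equation `∂ᵤ g + J ∂ᵥ g + λ g = 0` with `J² = -1`: a solution on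
a connected open set vanishing on the real points vanishes identically. -/
lemma eqOn_zero_of_cauchyRiemann {J : Cl} (hJ : J * J = -1) {lam : ℝ} {D : Set ℂ}
    (hD : IsOpen D) (hDc : IsPreconnected D) {g : ℂ → Cl}
    (hg : ∀ z ∈ D, ∃ L : ℂ →L[ℝ] Cl, HasFDerivAt g L z ∧ L 1 + J * L Complex.I + lam • g z = 0)
    {r : ℝ} (hr : (r : ℂ) ∈ D) (h0 : ∀ t : ℝ, g t = 0) : EqOn g 0 D := by
  intro z hz
  refine SeparatingDual.eq_zero_of_forall_dual_eq_zero (R := ℝ) fun φ => ?_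
  let Φ : Cl →L[ℝ] ℂ := Complex.ofRealCLM.comp φ -
    Complex.I • Complex.ofRealCLM.comp (φ.comp (ContinuousLinearMap.mul ℝ Cl J))
  have hΦ : ∀ a, Φ a = φ a - Complex.I * φ (J * a) := fun a => by simp [Φ]
  have hΦJ : ∀ a, Φ (J * a) = Complex.I * Φ a := fun a => by
    rw [hΦ, hΦ, ← mul_assoc, hJ]
    simp only [neg_mul, one_mul, map_neg, Complex.ofReal_neg]
    linear_combination (φ (J * a) : ℂ) * Complex.I_mul_I
  have hdiff : DifferentiableOn ℂ (fun w : ℂ => Real.exp (lam * w.re) • Φ (g w)) D := by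
    intro w hw
    obtain ⟨L, hL, hCR⟩ := hg w hw
    have hE : HasFDerivAt (fun w : ℂ => Real.exp (lam * w.re))
        (Real.exp (lam * w.re) • lam • Complex.reCLM) w :=
      (Complex.reCLM.hasFDerivAt.const_mul lam).exp
    have hK := hE.smul (Φ.hasFDerivAt.comp w hL)
    refine (differentiableAt_complex_iff_differentiableAt_real.2
      ⟨hK.differentiableAt, ?_⟩).differentiableWithinAt
    have hCR' := congrArg Φ hCR
    rw [map_add, map_add, hΦJ, map_smul, map_zero, Complex.real_smul] at hCR'
    rw [HasFDerivAt.fderiv hK]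
    simp
    linear_combination (-Complex.I * Complex.exp (lam * w.re)) * hCR' +
      (Complex.exp (lam * w.re) * Φ (L Complex.I)) * Complex.I_mul_I
  have hfreq : ∃ᶠ w in 𝓝[≠] (r : ℂ), Real.exp (lam * w.re) • Φ (g w) = 0 := by
    have ht : Filter.Tendsto ((↑) : ℝ → ℂ) (𝓝[≠] r) (𝓝[≠] (r : ℂ)) :=
      Complex.continuous_ofReal.continuousWithinAt.tendsto_nhdsWithin fun t ht => by
        simpa using ht
    exact ht.frequently (Filter.Frequently.of_forall fun t => by simp [h0])
  have h := (hdiff.analyticOnNhd hD).eqOn_zero_of_preconnected_of_frequently_eq_zero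
    hDc hr hfreq hz
  have h' : Φ (g z) = 0 := by simpa using h
  simpa [hΦ] using congrArg Complex.re h'

/-- Representation formula for λ-slice monogenic functions. -/
theorem statement2 (e : Fin n → Cl) (he : CliffordRel e) (lam : ℝ)
    (U : Set (Pt n)) (hU : AxSymSDomain n U) (f : Pt n → Cl) (hf : SMlam e lam U f)
    (x : Fin n → ℝ) (hx : x ∈ USphere n) (y : Fin n → ℝ) (hy : y ∈ USphere n)
    (u v : ℝ) (hxv : ((u, v • x) : Pt n) ∈ U) :
    f (u, v • x)
      = (2:ℝ)⁻¹ • ((1 - vecEmb e x * vecEmb e y) * f (u, v • y))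
        + (2:ℝ)⁻¹ • ((1 + vecEmb e x * vecEmb e y) * f (u, (-v) • y)) := by
  obtain ⟨hUo, -, ⟨r, hr⟩, hUc, hUs⟩ := hU
  set J := vecEmb e x
  set I := vecEmb e y
  have hI : I * I = -1 := vecEmb_mul_self he hy
  have hJ : J * J = -1 := vecEmb_mul_self he hx
  have hny : -y ∈ USphere n := by simpa [USphere] using hy
  let D : Set ℂ := {z | ((z.re, z.im • x) : Pt n) ∈ U}
  have hD : IsOpen D := hUo.preimage (by fun_prop)
  have hDc : IsPreconnected D := by
    have h := (hUc x hx).isPreconnected.image Complex.equivRealProdCLM.symm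
      Complex.equivRealProdCLM.symm.continuous.continuousOn
    convert h using 1
    ext z
    simp only [mem_image]
    exact ⟨fun hz => ⟨(z.re, z.im), hz, by simp [Complex.ext_iff]⟩, by
      rintro ⟨p, hp, rfl⟩
      simpa [D, SlicePre] using hp⟩
  let g : ℂ → Cl := fun z => (2 : ℝ) • f (z.re, z.im • x) -
    ((1 - J * I) * f (z.re, z.im • y) + (1 + J * I) * f (z.re, (-z.im) • y))
  have hg : ∀ z ∈ D, ∃ L : ℂ →L[ℝ] Cl,
      HasFDerivAt g L z ∧ L 1 + J * L Complex.I + lam • g z = 0 := by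
    intro z hz
    have hzc : (((starRingEnd ℂ z).re, (starRingEnd ℂ z).im • y) : Pt n) ∈ U := by
      simpa using hUs x hx (-y) hny _ _ hz
    obtain ⟨A, hA, hA'⟩ := hf.exists_hasFDerivAt hUo hx hz
    obtain ⟨B, hB, hB'⟩ := hf.exists_hasFDerivAt hUo hy (hUs x hx y hy _ _ hz)
    obtain ⟨C, hC, hC'⟩ := hf.exists_hasFDerivAt hUo hy hzc
    have hC2 : HasFDerivAt (fun w : ℂ => f (w.re, (-w.im) • y))
        (C.comp (Complex.conjCLE : ℂ →L[ℝ] ℂ)) z :=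
      HasFDerivAt.comp z hC (Complex.conjCLE : ℂ →L[ℝ] ℂ).hasFDerivAt
    refine ⟨_, (hA.const_smul (2 : ℝ)).sub
      ((hB.const_mul (1 - J * I)).add (hC2.const_mul (1 + J * I))), ?_⟩
    have hI' : ∀ a, I * (I * a) = -a := fun a => by rw [← mul_assoc, hI, neg_one_mul]
    have hJ' : ∀ a, J * (J * a) = -a := fun a => by rw [← mul_assoc, hJ, neg_one_mul]
    rw [add_assoc, add_eq_zero_iff_eq_neg] at hA' hB' hC'
    change A 1 = -(J * _ + _) at hA'
    change B 1 = -(I * _ + _) at hB'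
    change C 1 = -(I * _ + _) at hC'
    simp [g, hA', hB', hC', mul_add, add_mul, mul_sub, sub_mul, mul_assoc, hI', hJ']
    module
  have h0 : ∀ t : ℝ, g t = 0 := fun t => by
    simp only [g, Complex.ofReal_re, Complex.ofReal_im, neg_zero, zero_smul, two_smul]
    noncomm_ring
  have h := eqOn_zero_of_cauchyRiemann hJ hD hDc hg (r := r) (by simpa [D] using hr) h0
    (x := ⟨u, v⟩) hxv
  have h2 : (2 : ℝ) • f (u, v • x) =
      (1 - J * I) * f (u, v • y) + (1 + J * I) * f (u, (-v) • y) := sub_eq_zero.1 h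
  rw [← smul_add, ← h2, inv_smul_smul₀ two_ne_zero]
end
end

section
/- Let λ ∈ ℝ and assume g ∈ C²([a,b], ℝ) with g′ > 0 and g″ + 2λg′ = 0, and h ∈ C²([0,c], ℝ) with h′ > 0 and h″ + 2λh′ = 0. Let f ∈ AC¹(S_{a,b,c}, ℝ_n) satisfy condition (m1) and let I ∈ 𝕊. Then for every u ∈ (a,b) and v ∈ (0,c): (∂/∂u + I ∂/∂v)[ (1/g′(u)) A_I(u) + (1/h′(v)) B_I(v) ] = 2λ [ (1/g′(u)) A_I(u) + I (1/h′(v)) B_I(v) ] + (1/g′(u)) A_I′(u) + I (1/h′(v)) B_I′(v), the last two summands being (_{RL}D_{a+0+,I}^{(α,β),(g,h)} f)(u+Iv, r, s). -/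
open scoped BigOperators
open Set

noncomputable section

variable {n : ℕ} {Cl : Type} [NormedRing Cl] [NormedAlgebra ℝ Cl]

/-- If `w' + 2μw = 0` and `w > 0` on `[p, q]`, then `(w⁻¹F)' = 2μ(w⁻¹F) + w⁻¹F'` at interior
points. -/
theorem hasDerivAt_inv_smul_of_ode {E : Type*} [NormedAddCommGroup E] [NormedSpace ℝ E]
    {μ p q t : ℝ} {w w' : ℝ → ℝ} {F : ℝ → E}
    (hw : ∀ t ∈ Icc p q, HasDerivWithinAt w (w' t) (Icc p q) t)
    (hpos : ∀ t ∈ Icc p q, 0 < w t) (hode : ∀ t ∈ Icc p q, w' t + 2 * μ * w t = 0)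
    (hF : DifferentiableOn ℝ F (Icc p q)) (ht : t ∈ Ioo p q) :
    HasDerivAt (fun τ => (w τ)⁻¹ • F τ)
      ((2 * μ) • (w t)⁻¹ • F t + (w t)⁻¹ • deriv F t) t := by
  have hnhds : Icc p q ∈ nhds t := Icc_mem_nhds ht.1 ht.2
  have htc : t ∈ Icc p q := Ioo_subset_Icc_self ht
  have hne : w t ≠ 0 := (hpos t htc).ne'
  have hw' : w' t = -(2 * μ * w t) := by linarith [hode t htc]
  have hinv : HasDerivAt (fun τ => (w τ)⁻¹) (2 * μ * (w t)⁻¹) t := by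
    refine (((hw t htc).hasDerivAt hnhds).fun_inv hne).congr_deriv ?_
    rw [hw']
    field_simp
  refine (hinv.fun_smul (hF.differentiableAt hnhds).hasDerivAt).congr_deriv ?_
  rw [smul_smul, add_comm]

/-- the key identity relating the slice Cauchy–Riemann operator applied to
`(1/g′)A_I + (1/h′)B_I` with the slice Riemann–Liouville fractional derivative, when
`g″ + 2λg′ = 0` and `h″ + 2λh′ = 0`. -/
theorem statement8 [CompleteSpace Cl] (e : Fin n → Cl) (he : CliffordRel e)
    (lam a b c r s al be : ℝ)
    (hab : a < b) (hc : 0 < c) (hr : r ∈ Icc a b) (hs : s ∈ Icc 0 c)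
    (hal : al ∈ Ioo (0:ℝ) 1) (hbe : be ∈ Ioo (0:ℝ) 1)
    (g g' g'' h h' h'' : ℝ → ℝ)
    (hg1 : ∀ t ∈ Icc a b, HasDerivWithinAt g (g' t) (Icc a b) t)
    (hg2 : ∀ t ∈ Icc a b, HasDerivWithinAt g' (g'' t) (Icc a b) t)
    (hg3 : ContinuousOn g'' (Icc a b))
    (hgpos : ∀ t ∈ Icc a b, 0 < g' t)
    (hgode : ∀ t ∈ Icc a b, g'' t + 2 * lam * g' t = 0)
    (hh1 : ∀ t ∈ Icc 0 c, HasDerivWithinAt h (h' t) (Icc 0 c) t)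
    (hh2 : ∀ t ∈ Icc 0 c, HasDerivWithinAt h' (h'' t) (Icc 0 c) t)
    (hh3 : ContinuousOn h'' (Icc 0 c))
    (hhpos : ∀ t ∈ Icc 0 c, 0 < h' t)
    (hhode : ∀ t ∈ Icc 0 c, h'' t + 2 * lam * h' t = 0)
    (f : Pt n → Cl) (hf : AC1 a b c r s f) (hm1 : M1 a b c al be r s g g' h h' f)
    (x : Fin n → ℝ) (hx : x ∈ USphere n)
    (u v : ℝ) (hu : u ∈ Ioo a b) (hv : v ∈ Ioo 0 c) :
    deriv (fun t => (g' t)⁻¹ • AIfun a al s g g' f x t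
        + (h' v)⁻¹ • BIfun be r h h' f x v) u
      + vecEmb e x * deriv (fun t => (g' u)⁻¹ • AIfun a al s g g' f x u
        + (h' t)⁻¹ • BIfun be r h h' f x t) v
    = (2 * lam) • ((g' u)⁻¹ • AIfun a al s g g' f x u
        + vecEmb e x * ((h' v)⁻¹ • BIfun be r h h' f x v))
      + ((g' u)⁻¹ • deriv (AIfun a al s g g' f x) u
        + vecEmb e x * ((h' v)⁻¹ • deriv (BIfun be r h h' f x) v)) := by
  obtain ⟨hA, hB⟩ := hm1 x hx
  have hdA := hasDerivAt_inv_smul_of_ode hg2 hgpos hgode (hA.differentiableOn one_ne_zero) hu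
  have hdB := hasDerivAt_inv_smul_of_ode hh2 hhpos hhode (hB.differentiableOn one_ne_zero) hv
  rw [(hdA.add_const _).deriv, (hdB.const_add _).deriv, mul_add, mul_smul_comm, smul_add]
  abel
end
end
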